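/- Let W be a Weyl group with simple roots Π, v ∈ W, and set J_v = {α ∈ Π | ℓ(s_α v) < ℓ(v)}. If for every α ∈ J_v there exists β ∈ Π such that v s_β = s_α v, then v = w_{J_v}, the longest element of the parabolic subgroup W_{J_v}. -/

import Mathlib

/-!
STATEMENT 3: If for every `α` in the left descent set `J_v` of `v` there is `β ∈ Π`
with `v s_β = s_α v`, then `v` is the longest element of the parabolic subgroup `W_{J_v}`.
-/

open scoped Classical

section
variable {B W : Type*} [Group W] [Finite W] {M : CoxeterMatrix B}

/-- The parabolic subgroup `W_J` generated by the simple reflections `s_α`, `α ∈ J`. -/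
def parabolic (cs : CoxeterSystem M W) (J : Set B) : Subgroup W :=
  Subgroup.closure (cs.simple '' J)

/-- `w` is the longest element of the parabolic subgroup `W_J`. -/
def IsLongestIn (cs : CoxeterSystem M W) (J : Set B) (w : W) : Prop :=
  w ∈ parabolic cs J ∧ ∀ v ∈ parabolic cs J, cs.length v ≤ cs.length w

/-- The set `Π ∩ xΠ` of simple roots mapped to simple roots by `x`, described
combinatorially: `Π ∩ xΠ = {β ∈ Π | ∃ α ∈ Π, s_β = x s_α x⁻¹ and ℓ(x s_α) = ℓ(x) + 1}`. -/
def simpleCap (cs : CoxeterSystem M W) (x : W) : Set B :=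
  {i | ∃ j, cs.simple i * x = x * cs.simple j ∧
    cs.length (x * cs.simple j) = cs.length x + 1}

/-- The weak right order on `W`: `v ≤_R w` iff `w = v u` with `ℓ(w) = ℓ(v) + ℓ(u)`. -/
def leR (cs : CoxeterSystem M W) (v w : W) : Prop :=
  ∃ u : W, w = v * u ∧ cs.length w = cs.length v + cs.length u

end

namespace CoxeterSystem

variable {B W : Type*} [Group W] {M : CoxeterMatrix B}

theorem _root_.Function.End.mul_apply {α : Type*} (f g : Function.End α) (x : α) :
    (f * g) x = f (g x) := rfl

theorem _root_.Function.End.one_apply {α : Type*} (x : α) : (1 : Function.End α) x = x := rfl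

/-- For an involution `a`, the map `(t, ε) ↦ (a t a, ε + [t = a])`, which records in the second
coordinate whether conjugation by `a` is applied to `a` itself. -/
noncomputable def signedConj (a : W) : Function.End (W × ZMod 2) :=
  fun p ↦ (a * p.1 * a, p.2 + if p.1 = a then 1 else 0)

theorem signedConj_mul_pow_apply {a b : W} (ha : a * a = 1) (hb : b * b = 1) (n : ℕ)
    (x : W) (ε : ZMod 2) :
    ((signedConj a * signedConj b) ^ n : Function.End (W × ZMod 2)) (x, ε) =
      ((a * b) ^ n * x * (b * a) ^ n,
        ε + ∑ k ∈ Finset.range (2 * n), if x = (b * a) ^ k * b then 1 else 0) := by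
  have ha' : a⁻¹ = a := inv_eq_of_mul_eq_one_left ha
  have hb' : b⁻¹ = b := inv_eq_of_mul_eq_one_left hb
  induction n generalizing x ε with
  | zero => simp [Function.End.one_apply]
  | succ n ih =>
    have h₁ : (b * x * b = a) ↔ x = (b * a) ^ (0 + 1) * b := by
      constructor
      · rintro rfl
        simp [mul_assoc, hb]
        simp [← mul_assoc, hb]
      · rintro rfl
        simp [mul_assoc, hb]
        simp [← mul_assoc, hb]
    have h₂ (k : ℕ) : (a * (b * x * b) * a = (b * a) ^ k * b) ↔
        x = (b * a) ^ (k + 1 + 1) * b := by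
      have : a * (b * x * b) * a = (b * a)⁻¹ * x * (b * a) := by
        simp [mul_assoc, ha', hb']
      rw [this, mul_assoc, inv_mul_eq_iff_eq_mul, ← eq_mul_inv_iff_mul_eq]
      have : b * a * ((b * a) ^ k * b) * (b * a)⁻¹ = (b * a) ^ (k + 1 + 1) * b := by
        rw [pow_succ (b * a) (k + 1), pow_succ' (b * a) k]
        simp [mul_assoc, ha', hb']
      rw [this]
    have hstep : (signedConj a * signedConj b : Function.End (W × ZMod 2)) (x, ε) =
        (a * (b * x * b) * a,
          (ε + if x = b then 1 else 0) + if b * x * b = a then 1 else 0) := rfl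
    rw [pow_succ, Function.End.mul_apply, hstep, ih, Prod.mk.injEq]
    constructor
    · rw [pow_succ (a * b), pow_succ' (b * a)]
      simp only [mul_assoc]
    · rw [Nat.mul_succ, Finset.sum_range_succ', Finset.sum_range_succ']
      simp only [h₁, h₂, pow_zero, one_mul]
      ring

theorem isLiftable_signedConj (cs : CoxeterSystem M W) :
    M.IsLiftable fun i ↦ signedConj (cs.simple i) := by
  intro i j
  funext ⟨x, ε⟩
  rw [signedConj_mul_pow_apply (cs.simple_mul_simple_self i) (cs.simple_mul_simple_self j)]
  simp only [simple_mul_simple_pow, simple_mul_simple_pow', one_mul, mul_one, two_mul,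
    Finset.sum_range_add, pow_add]
  rw [CharTwo.add_self_eq_zero, add_zero]
  rfl

/-- The action of `W` on `W × ZMod 2` in which `s i` acts by `signedConj (s i)`. -/
noncomputable def signedConjHom (cs : CoxeterSystem M W) : W →* Function.End (W × ZMod 2) :=
  cs.lift ⟨_, cs.isLiftable_signedConj⟩

theorem signedConjHom_simple (cs : CoxeterSystem M W) (i : B) :
    cs.signedConjHom (cs.simple i) = signedConj (cs.simple i) :=
  cs.lift_apply_simple _ i

theorem signedConjHom_apply (cs : CoxeterSystem M W) (w t : W) (ε : ZMod 2) :
    cs.signedConjHom w (t, ε) = (w * t * w⁻¹, ε + (cs.signedConjHom w (t, 0)).2) := by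
  suffices ∃ c, ∀ ε, cs.signedConjHom w (t, ε) = (w * t * w⁻¹, ε + c) by
    obtain ⟨c, hc⟩ := this
    simp [hc]
  clear ε
  induction w using cs.simple_induction_left with
  | one => exact ⟨0, by simp [Function.End.one_apply]⟩
  | mul_simple_left w i ih =>
    obtain ⟨c, hc⟩ := ih
    refine ⟨c + if w * t * w⁻¹ = cs.simple i then 1 else 0, fun ε ↦ ?_⟩
    rw [map_mul, Function.End.mul_apply, hc, signedConjHom_simple]
    simp [signedConj, mul_assoc, add_assoc]

/-- The parity of the number of occurrences of `t` in the left inversion sequence of any word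
for `w`. -/
noncomputable def leftInvParity (cs : CoxeterSystem M W) (w t : W) : ZMod 2 :=
  (cs.signedConjHom w⁻¹ (t, 0)).2

section leftInvParity

variable (cs : CoxeterSystem M W)

theorem leftInvParity_one (t : W) : cs.leftInvParity 1 t = 0 := by
  simp [leftInvParity, Function.End.one_apply]

theorem leftInvParity_simple (i : B) (t : W) :
    cs.leftInvParity (cs.simple i) t = if t = cs.simple i then 1 else 0 := by
  simp [leftInvParity, signedConjHom_simple, signedConj]

theorem leftInvParity_mul (x y t : W) :
    cs.leftInvParity (x * y) t =
      cs.leftInvParity x t + cs.leftInvParity y (x⁻¹ * t * x) := by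
  rw [leftInvParity, mul_inv_rev, map_mul, Function.End.mul_apply,
    cs.signedConjHom_apply x⁻¹, cs.signedConjHom_apply y⁻¹]
  simp [leftInvParity]

theorem leftInvParity_self {t : W} (ht : cs.IsReflection t) : cs.leftInvParity t t = 1 := by
  obtain ⟨w, i, rfl⟩ := ht
  have h := cs.leftInvParity_mul w w⁻¹ (w * cs.simple i * w⁻¹)
  rw [mul_inv_cancel, leftInvParity_one] at h
  rw [leftInvParity_mul, leftInvParity_mul, leftInvParity_simple]
  simp only [mul_assoc, mul_inv_rev, inv_mul_cancel_left, inv_mul_cancel, mul_one, inv_simple,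
    simple_mul_simple_cancel_left, if_true] at h ⊢
  rw [add_right_comm, ← h, zero_add]

theorem mem_leftInvSeq_of_leftInvParity_ne_zero {ω : List B} {t : W}
    (h : cs.leftInvParity (cs.wordProd ω) t ≠ 0) : t ∈ cs.leftInvSeq ω := by
  induction ω generalizing t with
  | nil => simp [leftInvParity_one] at h
  | cons i ω ih =>
    rw [wordProd_cons, leftInvParity_mul, leftInvParity_simple] at h
    rw [leftInvSeq, List.mem_cons, List.mem_map]
    by_cases hti : t = cs.simple i
    · exact Or.inl hti
    · rw [if_neg hti, zero_add] at h
      exact Or.inr ⟨_, ih h, by simp [mul_assoc]⟩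

theorem leftInvParity_ne_zero_iff {w t : W} (ht : cs.IsReflection t) :
    cs.leftInvParity w t ≠ 0 ↔ cs.IsLeftInversion w t := by
  have key {x : W} (hx : cs.leftInvParity x t ≠ 0) : cs.IsLeftInversion x t := by
    obtain ⟨ω, hω, rfl⟩ := cs.exists_isReduced x
    exact cs.isLeftInversion_of_mem_leftInvSeq hω
      (cs.mem_leftInvSeq_of_leftInvParity_ne_zero hx)
  refine ⟨key, fun hw h₀ ↦ ht.not_isLeftInversion_mul_right_iff.mpr hw (key ?_)⟩
  rw [leftInvParity_mul, cs.leftInvParity_self ht, inv_mul_cancel, one_mul, h₀]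
  simp

/-- The strong exchange property. -/
theorem IsLeftInversion.exists_eraseIdx {ω : List B} {t : W}
    (h : cs.IsLeftInversion (cs.wordProd ω) t) :
    ∃ k < ω.length, t * cs.wordProd ω = cs.wordProd (ω.eraseIdx k) := by
  obtain ⟨k, hk, rfl⟩ := List.mem_iff_getElem.mp
    (cs.mem_leftInvSeq_of_leftInvParity_ne_zero ((cs.leftInvParity_ne_zero_iff h.1).mpr h))
  rw [← List.getD_eq_getElem _ 1, getD_leftInvSeq_mul_wordProd]
  exact ⟨k, by simpa using hk, rfl⟩

end leftInvParity

section parabolic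

variable (cs : CoxeterSystem M W) {J : Set B}

theorem wordProd_mem_parabolic {ω : List B} (hω : ∀ i ∈ ω, i ∈ J) :
    cs.wordProd ω ∈ parabolic cs J := by
  refine Subgroup.list_prod_mem _ fun x hx ↦ ?_
  obtain ⟨i, hi, rfl⟩ := List.mem_map.mp hx
  exact Subgroup.subset_closure ⟨i, hω i hi, rfl⟩

theorem exists_word_of_mem_parabolic {x : W} (hx : x ∈ parabolic cs J) :
    ∃ ω : List B, (∀ i ∈ ω, i ∈ J) ∧ cs.wordProd ω = x := by
  induction hx using Subgroup.closure_induction with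
  | mem x hx =>
    obtain ⟨i, hi, rfl⟩ := hx
    exact ⟨[i], by simpa, by simp⟩
  | one => exact ⟨[], by simp, by simp⟩
  | mul x y _ _ ihx ihy =>
    obtain ⟨ω, hω, rfl⟩ := ihx
    obtain ⟨ω', hω', rfl⟩ := ihy
    refine ⟨ω ++ ω', fun i hi ↦ ?_, cs.wordProd_append ω ω'⟩
    exact (List.mem_append.mp hi).elim (hω i) (hω' i)
  | inv x _ ih =>
    obtain ⟨ω, hω, rfl⟩ := ih
    exact ⟨ω.reverse, by simpa using hω, cs.wordProd_reverse ω⟩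

theorem exists_isLeftDescent_of_wordProd_ne_one (ω : List B) (hω : ∀ i ∈ ω, i ∈ J)
    (h : cs.wordProd ω ≠ 1) : ∃ j ∈ J, cs.IsLeftDescent (cs.wordProd ω) j := by
  induction hn : ω.length using Nat.strong_induction_on generalizing ω with
  | _ n ih =>
    obtain _ | ⟨i, ω⟩ := ω
    · simp at h
    by_cases hi : cs.IsLeftDescent (cs.wordProd (i :: ω)) i
    · exact ⟨i, hω i (by simp), hi⟩
    have hi' : cs.IsLeftDescent (cs.wordProd ω) i := by
      rw [isLeftDescent_iff_not_isLeftDescent_mul, ← wordProd_cons]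
      exact hi
    obtain ⟨k, hk, hprod⟩ := IsLeftInversion.exists_eraseIdx cs
      ((cs.isLeftInversion_simple_iff_isLeftDescent _ i).mpr hi')
    rw [← wordProd_cons] at hprod
    rw [hprod] at h ⊢
    refine ih _ ?_ _ (fun j hj ↦ hω j (List.mem_cons_of_mem _ (List.mem_of_mem_eraseIdx hj)))
      h rfl
    rw [← hn, List.length_cons]
    exact Nat.lt_succ_of_le (List.length_eraseIdx_le ..)

theorem isReflection_conj_inv {t : W} (ht : cs.IsReflection t) (x : W) :
    cs.IsReflection (x⁻¹ * t * x) := by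
  simpa using ht.conj x⁻¹

/-- An element of `W_J` having every element of `J` as a left descent is the longest one. -/
theorem isLongestIn_of_forall_isLeftDescent [Finite W] {v : W} (hv : v ∈ parabolic cs J)
    (h : ∀ j ∈ J, cs.IsLeftDescent v j) : IsLongestIn cs J v := by
  obtain ⟨m, hm, hmax⟩ := Set.exists_max_image (parabolic cs J : Set W) cs.length
    (Set.toFinite _) ⟨v, hv⟩
  suffices v * m⁻¹ = 1 by
    rw [mul_inv_eq_one.mp this]
    exact ⟨hm, hmax⟩
  by_contra hne
  have hx : v * m⁻¹ ∈ parabolic cs J := mul_mem hv (inv_mem hm)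
  obtain ⟨ω, hω, hωx⟩ := cs.exists_word_of_mem_parabolic hx
  obtain ⟨j, hj, hdesc⟩ := cs.exists_isLeftDescent_of_wordProd_ne_one ω hω (hωx ▸ hne)
  rw [hωx] at hdesc
  set x := v * m⁻¹ with hxdef
  have hs := cs.isReflection_simple j
  have ht := cs.isReflection_conj_inv hs x
  have hjJ : cs.simple j ∈ parabolic cs J := Subgroup.subset_closure ⟨j, hj, rfl⟩
  have hxs : cs.leftInvParity x (cs.simple j) ≠ 0 :=
    (cs.leftInvParity_ne_zero_iff hs).mpr (by simpa using hdesc)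
  have hvs : cs.leftInvParity v (cs.simple j) ≠ 0 :=
    (cs.leftInvParity_ne_zero_iff hs).mpr (by simpa using h j hj)
  have hms : cs.leftInvParity m (x⁻¹ * cs.simple j * x) ≠ 0 := by
    refine (cs.leftInvParity_ne_zero_iff ht).mpr ⟨ht, lt_of_le_of_ne ?_ ?_⟩
    · exact hmax _ (mul_mem (mul_mem (mul_mem (inv_mem hx) hjJ) hx) hm)
    · exact ht.length_mul_right_ne m
  have hsum := cs.leftInvParity_mul x m (cs.simple j)
  rw [hxdef, inv_mul_cancel_right, ← hxdef] at hsum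
  have hadd : ∀ a b : ZMod 2, a ≠ 0 → b ≠ 0 → a + b = 0 := by decide
  exact hvs (hsum.trans (hadd _ _ hxs hms))

/-- Every element is a reduced product of a word in `J` and an element without left descents
in `J`. -/
theorem exists_wordProd_mul_eq (J : Set B) (v : W) :
    ∃ (ω : List B) (u : W), (∀ i ∈ ω, i ∈ J) ∧ cs.wordProd ω * u = v ∧
      cs.length v = ω.length + cs.length u ∧ ∀ j ∈ J, ¬ cs.IsLeftDescent u j := by
  induction hn : cs.length v using Nat.strong_induction_on generalizing v with
  | _ n ih =>
    by_cases h : ∀ j ∈ J, ¬ cs.IsLeftDescent v j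
    · exact ⟨[], v, by simp, by simp, by simp [hn], h⟩
    push Not at h
    obtain ⟨j, hj, hdesc⟩ := h
    obtain ⟨ω, u, hω, hprod, hlen, hu⟩ := ih _ (hn ▸ hdesc) (cs.simple j * v) rfl
    refine ⟨j :: ω, u, by simpa using ⟨hj, hω⟩, ?_, ?_, hu⟩
    · rw [wordProd_cons, mul_assoc, hprod, simple_mul_simple_cancel_left]
    · have := cs.isLeftDescent_iff.mp hdesc
      rw [List.length_cons]
      lia

theorem exists_word_conj {ω : List B} {v : W}
    (h : ∀ i ∈ ω, ∃ j, v * cs.simple j = cs.simple i * v) :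
    ∃ ω' : List B, ω'.length = ω.length ∧ v * cs.wordProd ω' = cs.wordProd ω * v := by
  induction ω with
  | nil => exact ⟨[], by simp⟩
  | cons i ω ih =>
    obtain ⟨j, hj⟩ := h i (by simp)
    obtain ⟨ω', hlen, hprod⟩ := ih fun k hk ↦ h k (by simp [hk])
    refine ⟨j :: ω', by simp [hlen], ?_⟩
    rw [wordProd_cons, wordProd_cons, ← mul_assoc, hj, mul_assoc, hprod, mul_assoc]

end parabolic

end CoxeterSystem

theorem eq_longest_of_descents_conjugate
    {B W : Type*} [Group W] [Finite W] {M : CoxeterMatrix B}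
    (cs : CoxeterSystem M W) (v : W)
    (h : ∀ i ∈ {i : B | cs.length (cs.simple i * v) < cs.length v},
      ∃ j : B, v * cs.simple j = cs.simple i * v) :
    IsLongestIn cs {i : B | cs.length (cs.simple i * v) < cs.length v} v := by
  set J : Set B := {i : B | cs.length (cs.simple i * v) < cs.length v}
  obtain ⟨ω, u, hω, hprod, hlen, hu⟩ := cs.exists_wordProd_mul_eq J v
  obtain ⟨ω', hlen', hprod'⟩ := cs.exists_word_conj fun i hi ↦ h i (hω i hi)
  have hv : v = u * cs.wordProd ω' := by
    rw [← hprod, mul_assoc] at hprod'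
    rw [mul_left_cancel hprod', hprod]
  have hu1 : u = 1 := by
    by_contra hne
    obtain ⟨k, hk⟩ := cs.exists_leftDescent_of_ne_one hne
    refine hu k ?_ hk
    have h₁ := cs.isLeftDescent_iff.mp hk
    have h₂ := cs.length_mul_le (cs.simple k * u) (cs.wordProd ω')
    have h₃ := cs.length_wordProd_le ω'
    rw [mul_assoc, ← hv] at h₂
    change cs.length _ < cs.length _
    lia
  rw [hu1, mul_one] at hprod
  exact cs.isLongestIn_of_forall_isLeftDescent (hprod ▸ cs.wordProd_mem_parabolic hω)
    fun j hj ↦ hj
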